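/- arXiv:1912.11611 — 3 statements merged into one kernel-verified Lean document; each statement's English description precedes it below -/
import Mathlib

section
/- Amplitudes of Hadamard–Toffoli circuits on basis states are dyadic (the paper's Claim 1): if a circuit (a list of operations, each either a Hadamard gate H_k or precomposition with a permutation σ of Fin N → Bool) containing exactly h Hadamard operations is applied to a standard basis state e_x, then there exists an integer-valued function α : (Fin N → Bool) → ℤ such that every amplitude of the resulting state equals α(y) / (√2)^h; consequently every squared amplitude equals α(y)² / 2^h. -/
/-- A state on `N` qubits: a real amplitude for each basis label. -/
def QState (N : ℕ) := (Fin N → Bool) → ℝ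

/-- The Hadamard gate acting on qubit `k`. -/
noncomputable def Hgate {N : ℕ} (k : Fin N) (ψ : QState N) : QState N :=
  fun y => (1 / Real.sqrt 2) *
    (ψ (Function.update y k false) +
      (if y k then (-1 : ℝ) else 1) * ψ (Function.update y k true))

/-- An operation in a circuit: either a Hadamard gate on some qubit, or a
permutation of the basis labels (modelling Toffoli and other classical
reversible gates). -/
inductive Op (N : ℕ)
  | had (k : Fin N)
  | perm (σ : Equiv.Perm (Fin N → Bool))

/-- The action of an operation on a state. -/
noncomputable def Op.apply {N : ℕ} : Op N → QState N → QState N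
  | .had k, ψ => Hgate k ψ
  | .perm σ, ψ => ψ ∘ σ

/-- Run a circuit (a list of operations, applied left to right) on a state. -/
noncomputable def runCircuit {N : ℕ} (C : List (Op N)) (ψ : QState N) : QState N :=
  C.foldl (fun φ op => op.apply φ) ψ

/-- The number of Hadamard operations in a circuit. -/
def hadCount {N : ℕ} (C : List (Op N)) : ℕ :=
  C.countP (fun op => match op with | .had _ => true | .perm _ => false)

/-- The standard basis state labelled by `x`. -/
def basisState {N : ℕ} (x : Fin N → Bool) : QState N :=
  fun y => if y = x then 1 else 0

/-- Running a circuit on a state with amplitudes in `ℤ / √2 ^ m` gives amplitudes in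
`ℤ / √2 ^ (m + hadCount C)`. -/
theorem exists_int_runCircuit_eq_div {N : ℕ} (C : List (Op N)) (m : ℕ) (ψ : QState N)
    (hψ : ∃ α : (Fin N → Bool) → ℤ, ∀ y, ψ y = (α y : ℝ) / (Real.sqrt 2) ^ m) :
    ∃ α : (Fin N → Bool) → ℤ,
      ∀ y, runCircuit C ψ y = (α y : ℝ) / (Real.sqrt 2) ^ (m + hadCount C) := by
  induction C generalizing m ψ with
  | nil => simpa [runCircuit, hadCount] using hψ
  | cons op C ih =>
    obtain ⟨α, hα⟩ := hψ
    cases op with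
    | had k =>
      have hcount : m + hadCount (Op.had k :: C) = m + 1 + hadCount C := by
        simp only [hadCount, List.countP_cons, if_true]
        ring
      rw [hcount]
      refine ih (m + 1) (Hgate k ψ) ⟨fun y => α (Function.update y k false) +
        (if y k then -1 else 1) * α (Function.update y k true), fun y => ?_⟩
      simp only [Hgate, hα]
      push_cast
      field_simp
      ring
    | perm σ =>
      have hcount : hadCount (Op.perm σ :: C) = hadCount C := by
        simp [hadCount]
      rw [hcount]
      exact ih m (ψ ∘ σ) ⟨α ∘ σ, fun y => hα (σ y)⟩

theorem circuit_amplitudes_dyadic {N : ℕ} (C : List (Op N)) (x : Fin N → Bool)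
    (h : ℕ) (hh : hadCount C = h) :
    ∃ α : (Fin N → Bool) → ℤ,
      (∀ y, runCircuit C (basisState x) y = (α y : ℝ) / (Real.sqrt 2) ^ h) ∧
      (∀ y, (runCircuit C (basisState x) y) ^ 2 = ((α y : ℝ)) ^ 2 / 2 ^ h) := by
  obtain ⟨α, hα⟩ := exists_int_runCircuit_eq_div C 0 (basisState x)
    ⟨fun y => if y = x then 1 else 0, fun y => by simp [basisState]⟩
  rw [zero_add, hh] at hα
  refine ⟨α, hα, fun y => ?_⟩
  rw [hα, div_pow, pow_right_comm, Real.sq_sqrt zero_le_two]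
end

section
/- Acceptance probabilities of Hadamard–Toffoli circuits are dyadic rationals with denominator 2^h: if a circuit containing exactly h Hadamard operations is applied to a standard basis state e_x, yielding final state ψ, then for every subset S of Fin N → Bool there exists a natural number a with 0 ≤ a ≤ 2^h such that ∑_{y ∈ S} (ψ(y))² = a / 2^h. -/
/-- Flipping the bit `k` of a basis label, as an equivalence. -/
def bitFlip {N : ℕ} (k : Fin N) : (Fin N → Bool) ≃ (Fin N → Bool) :=
  Function.Involutive.toPerm (fun y => Function.update y k (!y k)) (fun y => by simp)

theorem Hgate_sq_add_sq_bitFlip {N : ℕ} (k : Fin N) (ψ : QState N) (y : Fin N → Bool) :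
    Hgate k ψ y ^ 2 + Hgate k ψ (bitFlip k y) ^ 2 = ψ y ^ 2 + ψ (bitFlip k y) ^ 2 := by
  have hs : (1 / Real.sqrt 2) ^ 2 = 1 / 2 := by
    rw [div_pow, Real.sq_sqrt (by norm_num)]; norm_num
  have hflip : bitFlip k y = Function.update y k (!y k) := rfl
  have hy : Function.update y k (y k) = y := Function.update_eq_self k y
  cases hb : y k <;> rw [hb] at hy <;>
    simp only [Hgate, hflip, Function.update_idem,
      Function.update_self, hb, hy, mul_pow, hs, Bool.not_false, Bool.not_true, if_true,
      Bool.false_eq_true, if_false] <;> ring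

/-- The Hadamard gate preserves the squared norm. -/
theorem sum_sq_Hgate {N : ℕ} (k : Fin N) (ψ : QState N) :
    ∑ y, Hgate k ψ y ^ 2 = ∑ y, ψ y ^ 2 := by
  have h₁ := Equiv.sum_comp (bitFlip k) (fun y => Hgate k ψ y ^ 2)
  have h₂ := Equiv.sum_comp (bitFlip k) (fun y => ψ y ^ 2)
  have h₃ := Finset.sum_congr rfl
    (fun y (_ : y ∈ Finset.univ) => Hgate_sq_add_sq_bitFlip k ψ y)
  rw [Finset.sum_add_distrib, Finset.sum_add_distrib] at h₃
  linarith

theorem sum_sq_apply {N : ℕ} (op : Op N) (ψ : QState N) :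
    ∑ y, op.apply ψ y ^ 2 = ∑ y, ψ y ^ 2 := by
  cases op with
  | had k => exact sum_sq_Hgate k ψ
  | perm σ => exact Equiv.sum_comp σ (fun y => ψ y ^ 2)

theorem sum_sq_runCircuit {N : ℕ} (C : List (Op N)) (ψ : QState N) :
    ∑ y, runCircuit C ψ y ^ 2 = ∑ y, ψ y ^ 2 := by
  induction C generalizing ψ with
  | nil => rfl
  | cons op C ih => exact (ih (op.apply ψ)).trans (sum_sq_apply op ψ)

/-- Each Hadamard gate contributes one factor `1 / √2` to otherwise integral amplitudes. -/
theorem exists_int_amplitude_runCircuit {N : ℕ} (C : List (Op N)) (ψ : QState N) (m : ℕ)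
    (hψ : ∃ f : (Fin N → Bool) → ℤ, ∀ y, ψ y = (1 / Real.sqrt 2) ^ m * f y) :
    ∃ f : (Fin N → Bool) → ℤ,
      ∀ y, runCircuit C ψ y = (1 / Real.sqrt 2) ^ (m + hadCount C) * f y := by
  induction C generalizing ψ m with
  | nil => exact hψ
  | cons op C ih =>
    obtain ⟨f, hf⟩ := hψ
    cases op with
    | had k =>
      have hc : m + hadCount (Op.had k :: C) = m + 1 + hadCount C := by
        simp [hadCount]; ring
      rw [hc]
      refine ih (Hgate k ψ) (m + 1) ⟨fun y => f (Function.update y k false) +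
        (if y k then -1 else 1) * f (Function.update y k true), fun y => ?_⟩
      simp only [Hgate, hf]
      push_cast
      ring
    | perm σ =>
      have hc : hadCount (Op.perm σ :: C) = hadCount C := by simp [hadCount]
      rw [hc]
      exact ih (ψ ∘ σ) m ⟨f ∘ σ, fun y => hf (σ y)⟩

theorem circuit_acceptance_dyadic {N : ℕ} (C : List (Op N)) (x : Fin N → Bool)
    (h : ℕ) (hh : hadCount C = h) (S : Finset (Fin N → Bool)) :
    ∃ a : ℕ, a ≤ 2 ^ h ∧
      ∑ y ∈ S, (runCircuit C (basisState x) y) ^ 2 = (a : ℝ) / 2 ^ h := by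
  obtain ⟨f, hf⟩ := exists_int_amplitude_runCircuit C (basisState x) 0
    ⟨fun y => if y = x then 1 else 0, fun y => by simp [basisState]⟩
  rw [zero_add, hh] at hf
  have hs : ((1 / Real.sqrt 2) ^ h) ^ 2 = 1 / 2 ^ h := by
    rw [← pow_mul, mul_comm, pow_mul, div_pow, Real.sq_sqrt (by norm_num), one_pow,
      one_div_pow]
  have heq : ∑ y ∈ S, (runCircuit C (basisState x) y) ^ 2 =
      ((∑ y ∈ S, (f y).natAbs ^ 2 : ℕ) : ℝ) / 2 ^ h := by
    push_cast
    rw [Finset.sum_div]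
    refine Finset.sum_congr rfl fun y _ => ?_
    rw [hf, mul_pow, hs, Nat.cast_natAbs, Int.cast_abs, sq_abs]
    ring
  refine ⟨_, ?_, heq⟩
  have hle : ∑ y ∈ S, (runCircuit C (basisState x) y) ^ 2 ≤ 1 :=
    calc _ ≤ ∑ y, (runCircuit C (basisState x) y) ^ 2 :=
          Finset.sum_le_univ_sum_of_nonneg fun y => sq_nonneg _
      _ = 1 := by rw [sum_sq_runCircuit]; simp [basisState]
  rw [heq, div_le_one (by positivity)] at hle
  exact_mod_cast hle
end

section
/- The maximally mixed state separates amplified yes and no instances (the quantitative core of Proposition 1): let m : ℕ and P : Matrix (Fin (2^m)) (Fin (2^m)) ℂ with P.PosSemidef. (i) If there exists a unit vector ψ : Fin (2^m) → ℂ with (star ψ ⬝ᵥ (P *ᵥ ψ)).re ≥ 1 − 2^{-(m+2)}, then P.trace.re / 2^m > 2^{-(m+1)}. (ii) If every unit vector ψ satisfies (star ψ ⬝ᵥ (P *ᵥ ψ)).re ≤ 2^{-(m+2)}, then P.trace.re / 2^m ≤ 2^{-(m+2)}. -/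
open Matrix ComplexOrder

theorem Matrix.re_star_dotProduct_self {n : Type*} [Fintype n] (v : n → ℂ) :
    (star v ⬝ᵥ v).re = ∑ i, ‖v i‖ ^ 2 := by
  simp only [dotProduct, Pi.star_apply, Complex.re_sum]
  refine Finset.sum_congr rfl fun i _ => ?_
  rw [← Complex.normSq_eq_norm_sq, Complex.star_def, ← Complex.normSq_eq_conj_mul_self,
    Complex.ofReal_re]

open scoped MatrixOrder in
theorem Matrix.PosSemidef.re_star_dotProduct_mulVec_le {n : Type*} [Fintype n]
    {P : Matrix n n ℂ} (hP : P.PosSemidef) (v : n → ℂ) :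
    (star v ⬝ᵥ (P *ᵥ v)).re ≤ P.trace.re * ∑ i, ‖v i‖ ^ 2 := by
  classical
  obtain ⟨B, rfl⟩ := CStarAlgebra.nonneg_iff_eq_star_mul_self.mp hP.nonneg
  rw [star_eq_conjTranspose]
  have hform : (star v ⬝ᵥ ((Bᴴ * B) *ᵥ v)).re = ∑ k, ‖(B *ᵥ v) k‖ ^ 2 := by
    rw [← re_star_dotProduct_self, star_mulVec, ← mulVec_mulVec, dotProduct_mulVec]
  have htrace : (Bᴴ * B).trace.re = ∑ k, ∑ i, ‖B k i‖ ^ 2 := by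
    rw [Finset.sum_comm]
    simp only [trace, diag_apply, Complex.re_sum]
    exact Finset.sum_congr rfl fun i _ => re_star_dotProduct_self fun k => B k i
  rw [hform, htrace, Finset.sum_mul]
  refine Finset.sum_le_sum fun k _ => ?_
  calc ‖(B *ᵥ v) k‖ ^ 2 ≤ (∑ i, ‖B k i‖ * ‖v i‖) ^ 2 := by
        gcongr
        exact (norm_sum_le _ _).trans_eq (by simp only [norm_mul])
    _ ≤ _ := Finset.sum_mul_sq_le_sq_mul_sq _ _ _

theorem maximally_mixed_separates (m : ℕ)
    (P : Matrix (Fin (2 ^ m)) (Fin (2 ^ m)) ℂ) (hP : P.PosSemidef) :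
    ((∃ ψ : Fin (2 ^ m) → ℂ, (∑ i, ‖ψ i‖ ^ 2 = 1) ∧
        (star ψ ⬝ᵥ (P *ᵥ ψ)).re ≥ 1 - ((2 : ℝ) ^ (m + 2))⁻¹) →
      P.trace.re / 2 ^ m > ((2 : ℝ) ^ (m + 1))⁻¹) ∧
    ((∀ ψ : Fin (2 ^ m) → ℂ, (∑ i, ‖ψ i‖ ^ 2 = 1) →
        (star ψ ⬝ᵥ (P *ᵥ ψ)).re ≤ ((2 : ℝ) ^ (m + 2))⁻¹) →
      P.trace.re / 2 ^ m ≤ ((2 : ℝ) ^ (m + 2))⁻¹) := by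
  constructor
  · rintro ⟨ψ, hψ, hacc⟩
    have hle := hP.re_star_dotProduct_mulVec_le ψ
    rw [hψ, mul_one] at hle
    have hsmall : ((2 : ℝ) ^ (m + 2))⁻¹ ≤ 1 / 4 := by
      rw [pow_add, mul_inv]
      have := inv_le_one_of_one_le₀ (one_le_pow₀ (n := m) (one_le_two (α := ℝ)))
      linarith
    rw [gt_iff_lt, lt_div_iff₀ (by positivity), pow_succ, mul_inv, mul_right_comm,
      inv_mul_cancel₀ (by positivity)]
    linarith
  · intro hrej
    rw [div_le_iff₀ (by positivity)]
    have hdiag (i : Fin (2 ^ m)) : (P i i).re ≤ ((2 : ℝ) ^ (m + 2))⁻¹ := by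
      simpa using hrej (Pi.single i 1) (by simp [Pi.single_apply, apply_ite, ite_pow])
    calc P.trace.re = ∑ i, (P i i).re := by simp [trace]
      _ ≤ ∑ _i : Fin (2 ^ m), ((2 : ℝ) ^ (m + 2))⁻¹ := Finset.sum_le_sum fun i _ => hdiag i
      _ = ((2 : ℝ) ^ (m + 2))⁻¹ * 2 ^ m := by simp [mul_comm]
end
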